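/- Let Γ be a nonnegative random variable on a probability space, let v : [0,1] → ℝ be a concave, non-decreasing, non-negative function, and let c > 0. Define u : [0,c] → ℝ by u(y) = E[v(y/(y+Γ))] − y, with the convention that a fraction with zero denominator equals 0. Then u has at most one maximizer on [0,c]: if y_1, y_2 ∈ [0,c] both satisfy u(y_i) ≥ u(y) for all y ∈ [0,c], then y_1 = y_2. -/

import Mathlib

open MeasureTheory

/-- A concave function at a point beyond the midpoint of `[a, b]` exceeds the average of its end
values by at least a fixed positive multiple of its increment. -/
lemma ConcaveOn.exists_pos_mul_sub_le {s : Set ℝ} {v : ℝ → ℝ} (hv : ConcaveOn ℝ s v) {a m b : ℝ}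
    (ha : a ∈ s) (hb : b ∈ s) (hmb : m ≤ b) (hm : (a + b) / 2 < m) :
    ∃ ε > 0, (v a + v b) / 2 + ε * (v b - v a) ≤ v m := by
  have hab : 0 < b - a := by linarith
  have h := hv.2 ha hb (div_nonneg (sub_nonneg.2 hmb) hab.le)
    (div_nonneg (by linarith : 0 ≤ m - a) hab.le) (by field_simp; ring)
  have hpt : ((b - m) / (b - a)) • a + ((m - a) / (b - a)) • b = m := by
    simp only [smul_eq_mul]
    field_simp
    ring
  rw [hpt] at h
  refine ⟨(m - (a + b) / 2) / (b - a), div_pos (by linarith) hab, le_of_eq_of_le ?_ h⟩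
  simp only [smul_eq_mul]
  field_simp
  ring

lemma div_add_mem_Icc {y γ : ℝ} (hy : 0 ≤ y) (hγ : 0 ≤ γ) : y / (y + γ) ∈ Set.Icc (0 : ℝ) 1 :=
  ⟨by positivity, div_le_one_of_le₀ (by linarith) (by positivity)⟩

/-- The share `y / (y + γ)` is strictly midpoint concave in `y`, unless it is constantly one. -/
lemma midpoint_div_add_lt_or {y₁ y₂ γ : ℝ} (hy₁ : 0 ≤ y₁) (hy : y₁ < y₂) (hγ : 0 ≤ γ) :
    (y₁ / (y₁ + γ) + y₂ / (y₂ + γ)) / 2 < (y₁ + y₂) / 2 / ((y₁ + y₂) / 2 + γ) ∨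
      (y₁ / (y₁ + γ) = 1 ∧ y₂ / (y₂ + γ) = 1 ∧ (y₁ + y₂) / 2 / ((y₁ + y₂) / 2 + γ) = 1) := by
  have hy₂ : 0 < y₂ := hy₁.trans_lt hy
  have hm : 0 < (y₁ + y₂) / 2 := by linarith
  rcases hγ.eq_or_lt with rfl | hγ
  · rcases hy₁.eq_or_lt with rfl | hy₁
    · left
      rw [add_zero y₂, div_self hy₂.ne', add_zero ((0 + y₂) / 2), div_self hm.ne']
      norm_num
    · right
      simp only [add_zero]
      exact ⟨div_self hy₁.ne', div_self hy₂.ne', div_self hm.ne'⟩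
  · left
    rw [← sub_pos]
    have key : (y₁ + y₂) / 2 / ((y₁ + y₂) / 2 + γ) - (y₁ / (y₁ + γ) + y₂ / (y₂ + γ)) / 2 =
        γ * (y₂ - y₁) ^ 2 / (2 * (y₁ + y₂ + 2 * γ) * (y₁ + γ) * (y₂ + γ)) := by
      have h₁ : y₁ + γ ≠ 0 := by positivity
      have h₂ : y₂ + γ ≠ 0 := by positivity
      have h₃ : y₁ + y₂ + 2 * γ ≠ 0 := by positivity
      have h₄ : (y₁ + y₂) / 2 + γ = (y₁ + y₂ + 2 * γ) / 2 := by ring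
      rw [h₄]
      field_simp
      ring
    rw [key]
    have := sub_pos.2 hy
    positivity

lemma div_add_le_div_add {x y γ : ℝ} (hx : 0 < x) (hxy : x ≤ y) (hγ : 0 ≤ γ) :
    x / (x + γ) ≤ y / (y + γ) := by
  rw [div_le_div_iff₀ (by positivity) (by linarith)]
  nlinarith [mul_le_mul_of_nonneg_right hxy hγ]

lemma MonotoneOn.integrable_comp_Icc {Ω : Type*} [MeasurableSpace Ω] {P : Measure Ω}
    [IsFiniteMeasure P] {v : ℝ → ℝ} (hv : MonotoneOn v (Set.Icc 0 1)) {f : Ω → ℝ}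
    (hf : Measurable f) (hf01 : ∀ ω, f ω ∈ Set.Icc (0 : ℝ) 1) :
    Integrable (fun ω => v (f ω)) P := by
  have hmono : Monotone (fun x : ℝ => v (Set.projIcc (0 : ℝ) 1 zero_le_one x)) := fun x y hxy =>
    hv (Subtype.coe_prop _) (Subtype.coe_prop _) (Set.monotone_projIcc zero_le_one hxy)
  have hmeas : Measurable (fun ω => v (f ω)) := by
    convert hmono.measurable.comp hf using 2 with ω
    simp [Set.projIcc_of_mem zero_le_one (hf01 ω)]
  exact Integrable.of_mem_Icc (v 0) (v 1) hmeas.aemeasurable <| .of_forall fun ω =>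
    ⟨hv (by simp) (hf01 ω) (hf01 ω).1, hv (hf01 ω) (by simp) (hf01 ω).2⟩

/-- **Uniqueness of the best response.** Let `Γ` be a nonnegative random variable, `v` concave,
non-decreasing and non-negative on `[0,1]`, and `c > 0`. Then the expected utility
`u(y) = E[v(y/(y+Γ))] - y` has at most one maximizer on `[0, c]`. -/
theorem stmt_13
    {Ω : Type*} [MeasurableSpace Ω] (P : Measure Ω) [IsProbabilityMeasure P]
    (Γ : Ω → ℝ) (hΓmeas : Measurable Γ) (hΓnonneg : ∀ ω, 0 ≤ Γ ω)
    (v : ℝ → ℝ) (hconc : ConcaveOn ℝ (Set.Icc 0 1) v)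
    (hmono : MonotoneOn v (Set.Icc 0 1))
    (hnonneg : ∀ t ∈ Set.Icc (0:ℝ) 1, 0 ≤ v t)
    (c : ℝ) (hc : 0 < c)
    (u : ℝ → ℝ) (hu : u = fun y => (∫ ω, v (y / (y + Γ ω)) ∂P) - y)
    (y₁ y₂ : ℝ) (hy₁ : y₁ ∈ Set.Icc 0 c) (hy₂ : y₂ ∈ Set.Icc 0 c)
    (hmax₁ : ∀ y ∈ Set.Icc 0 c, u y ≤ u y₁)
    (hmax₂ : ∀ y ∈ Set.Icc 0 c, u y ≤ u y₂) :
    y₁ = y₂ := by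
  subst hu
  wlog hlt : y₁ < y₂ generalizing y₁ y₂
  · rcases eq_or_lt_of_not_gt hlt with h | h
    · exact h.symm
    · exact (this y₂ y₁ hy₂ hy₁ hmax₂ hmax₁ h).symm
  exfalso
  set m := (y₁ + y₂) / 2 with hm
  have hm0 : 0 < m := by linarith [hy₁.1]
  have hmc : m ∈ Set.Icc 0 c := ⟨hm0.le, by linarith [hy₂.2]⟩
  have hint (y : ℝ) (hy : y ∈ Set.Icc 0 c) : Integrable (fun ω => v (y / (y + Γ ω))) P :=
    hmono.integrable_comp_Icc (by fun_prop) fun ω => div_add_mem_Icc hy.1 (hΓnonneg ω)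
  have hgap (ω : Ω) : ∃ ε > 0, (v (y₁ / (y₁ + Γ ω)) + v (y₂ / (y₂ + Γ ω))) / 2 +
      ε * (v (y₂ / (y₂ + Γ ω)) - v (y₁ / (y₁ + Γ ω))) ≤ v (m / (m + Γ ω)) := by
    rcases midpoint_div_add_lt_or hy₁.1 hlt (hΓnonneg ω) with h | ⟨h₁, h₂, h₃⟩
    · exact hconc.exists_pos_mul_sub_le (div_add_mem_Icc hy₁.1 (hΓnonneg ω))
        (div_add_mem_Icc hy₂.1 (hΓnonneg ω))
        (div_add_le_div_add hm0 (by linarith) (hΓnonneg ω)) h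
    · refine ⟨1, one_pos, ?_⟩
      rw [h₁, h₂, hm, h₃]
      linarith
  have hle (ω : Ω) : v (y₁ / (y₁ + Γ ω)) ≤ v (y₂ / (y₂ + Γ ω)) := by
    refine hmono (div_add_mem_Icc hy₁.1 (hΓnonneg ω)) (div_add_mem_Icc hy₂.1 (hΓnonneg ω)) ?_
    rcases hy₁.1.eq_or_lt with h | h
    · rw [← h, zero_div]
      exact (div_add_mem_Icc hy₂.1 (hΓnonneg ω)).1
    · exact div_add_le_div_add h hlt.le (hΓnonneg ω)
  have hintAvg : Integrable
      (fun ω => (v (y₁ / (y₁ + Γ ω)) + v (y₂ / (y₂ + Γ ω))) / 2) P :=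
    ((hint y₁ hy₁).add (hint y₂ hy₂)).div_const 2
  have havg_le (ω : Ω) :
      (v (y₁ / (y₁ + Γ ω)) + v (y₂ / (y₂ + Γ ω))) / 2 ≤ v (m / (m + Γ ω)) := by
    obtain ⟨ε, hε, h⟩ := hgap ω
    nlinarith [mul_nonneg hε.le (sub_nonneg.2 (hle ω))]
  have h₁ := hmax₁ m hmc
  have h₂ := hmax₂ m hmc
  have h₁₂ := hmax₂ y₁ hy₁
  have hIntAvg : ∫ ω, (v (y₁ / (y₁ + Γ ω)) + v (y₂ / (y₂ + Γ ω))) / 2 ∂P =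
      ((∫ ω, v (y₁ / (y₁ + Γ ω)) ∂P) + ∫ ω, v (y₂ / (y₂ + Γ ω)) ∂P) / 2 := by
    rw [integral_div, integral_add (hint y₁ hy₁) (hint y₂ hy₂)]
  have hIntEq := (integral_mono hintAvg (hint m hmc) havg_le).antisymm
    (by rw [hIntAvg]; linarith)
  have hae := (integral_eq_iff_of_ae_le hintAvg (hint m hmc) (.of_forall havg_le)).1 hIntEq
  have heq : ∫ ω, v (y₁ / (y₁ + Γ ω)) ∂P = ∫ ω, v (y₂ / (y₂ + Γ ω)) ∂P := by
    refine integral_congr_ae ?_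
    filter_upwards [hae] with ω hω
    obtain ⟨ε, hε, h⟩ := hgap ω
    refine (hle ω).antisymm (sub_nonpos.1 (nonpos_of_mul_nonpos_right (a := ε) ?_ hε))
    linarith
  linarith
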